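/- arXiv:0901.1743 — 2 statements merged into one kernel-verified Lean document; each statement's English description precedes it below -/
import Mathlib

section
/- The operators of the regular representation satisfy the twisted commutation relations: for all I, J ∈ G, Π(I)∘Π(J) = exp(2πi·b/d)·Π(J)∘Π(I), where b ∈ ℤ is any integer representative of B(I,J) := Σ_{a,b∈ℤ} σ(I(a), A(b−a)·J(b)) ∈ ZMod d. -/
open scoped BigOperators InnerProductSpace
open Filter Topology Finset

noncomputable section

/-- The symplectic form `σ(k,l) = k₁l₂ − k₂l₁` on `R × R`. -/
def symp {R : Type*} [CommRing R] (k l : R × R) : R := k.1 * l.2 - k.2 * l.1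

/-- Matrix–vector product of a `2 × 2` matrix with a pair. -/
def mvec {R : Type*} [CommRing R] (A : Matrix (Fin 2) (Fin 2) R) (k : R × R) : R × R :=
  (A 0 0 * k.1 + A 0 1 * k.2, A 1 0 * k.1 + A 1 1 * k.2)

/-- The consistency condition `σ(k, A(−n)·l) = −σ(l, A(n)·k)` on the defining matrices. -/
def Consistent (d : ℕ) (A : ℤ → Matrix (Fin 2) (Fin 2) (ZMod d)) : Prop :=
  ∀ (n : ℤ) (k l : ZMod d × ZMod d),
    symp k (mvec (A (-n)) l) = - symp l (mvec (A n) k)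

/-- `c(I,J) = Σ_{a>b} σ(I(a), A(b−a)·J(b)) + Σ_a (I(a))₁·(J(a))₂ ∈ ZMod d`. -/
def cExp (d : ℕ) (A : ℤ → Matrix (Fin 2) (Fin 2) (ZMod d))
    (I J : ℤ →₀ (ZMod d × ZMod d)) : ZMod d :=
  (∑ a ∈ I.support, ∑ b ∈ J.support,
      if b < a then symp (I a) (mvec (A (b - a)) (J b)) else 0)
    + ∑ a ∈ I.support, (I a).1 * (J a).2

/-- The multiplier `ω(I,J) = exp(2πi·c(I,J)/d)` (using the representative `(c(I,J)).val`). -/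
def omegaMul (d : ℕ) (A : ℤ → Matrix (Fin 2) (Fin 2) (ZMod d))
    (I J : ℤ →₀ (ZMod d × ZMod d)) : ℂ :=
  Complex.exp (2 * Real.pi * Complex.I * ((cExp d A I J).val : ℂ) / d)

/-- The commutation exponent `B(I,J) = Σ_{a,b} σ(I(a), A(b−a)·J(b)) ∈ ZMod d`. -/
def Bexp (d : ℕ) (A : ℤ → Matrix (Fin 2) (Fin 2) (ZMod d))
    (I J : ℤ →₀ (ZMod d × ZMod d)) : ZMod d :=
  ∑ a ∈ I.support, ∑ b ∈ J.support, symp (I a) (mvec (A (b - a)) (J b))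

/-- The Hilbert space `ℓ²(G)` over the group `G` of finitely supported functions
`ℤ → (ZMod d)²`. -/
abbrev HS (d : ℕ) := lp (fun _ : ℤ →₀ (ZMod d × ZMod d) => ℂ) 2

/-- The standard orthonormal basis vector `e_J` of `ℓ²(G)`. -/
def eVec (d : ℕ) (J : ℤ →₀ (ZMod d × ZMod d)) : HS d := lp.single 2 J 1

/-- The shift on `G`: `(S I)(n) = I(n − 1)`. -/
def Sg {d : ℕ} (I : ℤ →₀ (ZMod d × ZMod d)) : ℤ →₀ (ZMod d × ZMod d) :=
  Finsupp.equivMapDomain (Equiv.addRight (1 : ℤ)) I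

lemma eqS_c (d : ℕ) (A : ℤ → Matrix (Fin 2) (Fin 2) (ZMod d))
    (I J : ℤ →₀ (ZMod d × ZMod d)) (S : Finset ℤ) (hI : I.support ⊆ S) (hJ : J.support ⊆ S) :
    cExp d A I J = (∑ a ∈ S, ∑ b ∈ S,
      if b < a then symp (I a) (mvec (A (b - a)) (J b)) else 0)
    + ∑ a ∈ S, (I a).1 * (J a).2 := by
  unfold cExp
  congr 1
  · rw [Finset.sum_subset hI]
    · refine Finset.sum_congr rfl fun a _ => Finset.sum_subset hJ ?_
      intro b _ hb
      have : J b = 0 := by simpa using hb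
      simp [this, symp, mvec]
    · intro a _ ha
      have : I a = 0 := by simpa using ha
      simp [this, symp]
  · refine Finset.sum_subset hI ?_
    intro a _ ha
    have : I a = 0 := by simpa using ha
    simp [this]

lemma eqS_B (d : ℕ) (A : ℤ → Matrix (Fin 2) (Fin 2) (ZMod d))
    (I J : ℤ →₀ (ZMod d × ZMod d)) (S : Finset ℤ) (hI : I.support ⊆ S) (hJ : J.support ⊆ S) :
    Bexp d A I J = ∑ a ∈ S, ∑ b ∈ S, symp (I a) (mvec (A (b - a)) (J b)) := by
  unfold Bexp
  rw [Finset.sum_subset hI]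
  · refine Finset.sum_congr rfl fun a _ => Finset.sum_subset hJ ?_
    intro b _ hb
    have : J b = 0 := by simpa using hb
    simp [this, symp, mvec]
  · intro a _ ha
    have : I a = 0 := by simpa using ha
    simp [this, symp]

lemma c_add (d : ℕ) (A : ℤ → Matrix (Fin 2) (Fin 2) (ZMod d))
    (I J K : ℤ →₀ (ZMod d × ZMod d)) :
    cExp d A I (J + K) = cExp d A I J + cExp d A I K := by
  classical
  set S := I.support ∪ (J.support ∪ K.support) with hS
  have hI : I.support ⊆ S := Finset.subset_union_left
  have hJ : J.support ⊆ S := Finset.subset_union_left.trans Finset.subset_union_right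
  have hK : K.support ⊆ S := Finset.subset_union_right.trans Finset.subset_union_right
  have hJK : (J + K).support ⊆ S := Finsupp.support_add.trans Finset.subset_union_right
  rw [eqS_c d A I _ S hI hJK, eqS_c d A I _ S hI hJ, eqS_c d A I _ S hI hK,
    add_add_add_comm]
  refine congrArg₂ (· + ·) ?_ ?_
  · rw [← Finset.sum_add_distrib]
    refine Finset.sum_congr rfl fun a _ => ?_
    rw [← Finset.sum_add_distrib]
    refine Finset.sum_congr rfl fun b _ => ?_
    split_ifs
    · simp [symp, mvec]; ring
    · simp
  · rw [← Finset.sum_add_distrib]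
    refine Finset.sum_congr rfl fun a _ => ?_
    simp [mul_add]

lemma c_comm (d : ℕ) (A : ℤ → Matrix (Fin 2) (Fin 2) (ZMod d)) (hA0 : A 0 = 1)
    (hA : Consistent d A) (I J : ℤ →₀ (ZMod d × ZMod d)) :
    cExp d A I J = Bexp d A I J + cExp d A J I := by
  classical
  set S := I.support ∪ J.support with hS
  have hI : I.support ⊆ S := Finset.subset_union_left
  have hJ : J.support ⊆ S := Finset.subset_union_right
  rw [eqS_c d A I J S hI hJ, eqS_c d A J I S hJ hI, eqS_B d A I J S hI hJ,
    Finset.sum_comm (s := S) (t := S) (f := fun a b =>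
      if b < a then symp (J a) (mvec (A (b - a)) (I b)) else 0),
    ← add_assoc, ← Finset.sum_add_distrib, ← Finset.sum_add_distrib, ← Finset.sum_add_distrib]
  refine Finset.sum_congr rfl fun a ha => ?_
  rw [← Finset.sum_add_distrib]
  have h1 : (I a).1 * (J a).2 = ∑ b ∈ S, if a = b then (I a).1 * (J a).2 else 0 := by
    simp [ha]
  have h2 : (J a).1 * (I a).2 = ∑ b ∈ S, if a = b then (J a).1 * (I a).2 else 0 := by
    simp [ha]
  rw [h1, h2, ← Finset.sum_add_distrib, ← Finset.sum_add_distrib]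
  refine Finset.sum_congr rfl fun b _ => ?_
  rcases lt_trichotomy a b with h | h | h
  · have := hA (b - a) (J b) (I a)
    rw [neg_sub] at this
    simp [h, h.not_gt, h.ne, this]
  · subst h
    simp [hA0, symp, mvec]; ring
  · simp [h, h.not_gt, h.ne']

lemma exp_eq (d : ℕ) [NeZero d] (x : ZMod d) :
    Complex.exp (2 * Real.pi * Complex.I * (x.val : ℂ) / d) = ZMod.stdAddChar x := by
  rw [ZMod.stdAddChar_apply, ZMod.toCircle_apply]

/-- The regular representation satisfies the twisted commutation relations:
`Π(I)∘Π(J) = exp(2πi·B(I,J)/d)·Π(J)∘Π(I)` for all `I, J ∈ G`. -/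
theorem stmt2 (d : ℕ) (hd : 2 ≤ d)
    (A : ℤ → Matrix (Fin 2) (Fin 2) (ZMod d)) (hA0 : A 0 = 1) (hA : Consistent d A)
    (rep : (ℤ →₀ (ZMod d × ZMod d)) → (HS d →L[ℂ] HS d))
    (hrep : ∀ I J, rep I (eVec d J) = omegaMul d A I J • eVec d (I + J)) :
    ∀ I J, rep I ∘L rep J =
      Complex.exp (2 * Real.pi * Complex.I * ((Bexp d A I J).val : ℂ) / d) •
        (rep J ∘L rep I) := by
  intro I J
  haveI : NeZero d := ⟨by omega⟩
  refine lp.ext_continuousLinearMap (by norm_num) fun K => ?_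
  ext
  have key : ∀ I J K, rep I (rep J (eVec d K)) =
      (ZMod.stdAddChar (cExp d A J K + cExp d A I (J + K)) : ℂ) • eVec d (I + (J + K)) := by
    intro I J K
    rw [hrep, map_smul, hrep, smul_smul, AddChar.map_add_eq_mul]
    simp only [omegaMul, exp_eq]
  have main : rep I (rep J (eVec d K)) =
      Complex.exp (2 * Real.pi * Complex.I * ((Bexp d A I J).val : ℂ) / d) •
        rep J (rep I (eVec d K)) := by
    rw [key, key, exp_eq, smul_smul, ← AddChar.map_add_eq_mul, c_add, c_add,
      c_comm d A hA0 hA I J, add_left_comm I J K]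
    congr 2
    ring
  simpa [eVec] using congrArg (fun f : HS d => f _) main
end
end

section
/- (Theorem 2) Suppose x ∈ X is typical for a shift-invariant Borel probability measure μ on X, that A := x satisfies A 0 = 1 and the consistency condition σ(k, A(−n)·l) = −σ(l, A(n)·k) for all n ∈ ℤ and k, l ∈ (ZMod d)², and that for every I ≠ 0 the nondegeneracy condition ∫_X F_I dμ ≠ 1 holds, where F_I(y) := exp(2πi·m(y)/d) with m(y) ∈ ℤ representing Σ_{a,b∈ℤ} σ(I(a), y(b−a)·I(b)) ∈ ZMod d. Then for every Hilbert space H, unit vector Ω ∈ H, map π : G → B(H) with each π(I) unitary, π(0) = 1 and π(I)∘π(J) = ω(I,J)·π(I+J), and unitary U on H with UΩ = Ω and U∘π(I)∘U⁻¹ = π(S I) for all I, the vector state is tracial: ⟨Ω, π(I)Ω⟩ = 0 for every I ≠ 0 and ⟨Ω, π(I)(π(J)Ω)⟩ = ⟨Ω, π(J)(π(I)Ω)⟩ for all I, J ∈ G. In other words, the tracial state is the only translation-invariant state on the twisted Weyl algebra defined by a typical nondegenerate sequence of matrices. -/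
open scoped BigOperators InnerProductSpace
open Filter Topology Finset MeasureTheory

noncomputable section

/-- `ZMod d` carries the discrete topology. -/
instance (d : ℕ) : TopologicalSpace (ZMod d) := ⊥

instance (d : ℕ) : DiscreteTopology (ZMod d) := ⟨rfl⟩

/-- The space `X = ℤ → V` of two-sided sequences of `2×2` matrices over `ZMod d`, with the
product topology, carries the Borel σ-algebra. -/
instance (d : ℕ) : MeasurableSpace (ℤ → Matrix (Fin 2) (Fin 2) (ZMod d)) := borel _

/-- The shift `T` on `X = ℤ → V`: `(T y)(n) = y(n+1)`. -/
def Tsh {d : ℕ} (y : ℤ → Matrix (Fin 2) (Fin 2) (ZMod d)) :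
    ℤ → Matrix (Fin 2) (Fin 2) (ZMod d) := fun n => y (n + 1)

/-- A point `x ∈ X` is typical for `μ` if time averages of continuous functions along the
orbit of `x` reproduce the `μ`-averages, and the corresponding correlation averages exist
and are asymptotically mixing. -/
def Typical (d : ℕ) (μ : Measure (ℤ → Matrix (Fin 2) (Fin 2) (ZMod d)))
    (x : ℤ → Matrix (Fin 2) (Fin 2) (ZMod d)) : Prop :=
  (∀ f : (ℤ → Matrix (Fin 2) (Fin 2) (ZMod d)) → ℂ, Continuous f →
      Tendsto (fun N : ℕ => (N : ℂ)⁻¹ * ∑ n ∈ Finset.range N, f (Tsh^[n] x)) atTop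
        (𝓝 (∫ y, f y ∂μ))) ∧
    ∀ f g : (ℤ → Matrix (Fin 2) (Fin 2) (ZMod d)) → ℂ, Continuous f → Continuous g →
      ∃ c : ℕ → ℂ,
        (∀ k : ℕ, Tendsto (fun N : ℕ => (N : ℂ)⁻¹ *
            ∑ n ∈ Finset.range N, f (Tsh^[n] x) * g (Tsh^[n + k] x)) atTop (𝓝 (c k))) ∧
        Tendsto c atTop (𝓝 ((∫ y, f y ∂μ) * ∫ y, g y ∂μ))


lemma aux_shift {E : Type*} [NormedAddCommGroup E] [NormedSpace ℂ E] (w : ℕ → E) (C : ℝ)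
    (hC : ∀ n, ‖w n‖ ≤ C) (h : ℕ) :
    Tendsto (fun N : ℕ => (N : ℂ)⁻¹ • (∑ n ∈ range N, w (n + h)) -
      (N : ℂ)⁻¹ • ∑ n ∈ range N, w n) atTop (𝓝 0) := by
  have hb : ∀ N : ℕ, ‖(N : ℂ)⁻¹ • (∑ n ∈ range N, w (n + h)) -
      (N : ℂ)⁻¹ • ∑ n ∈ range N, w n‖ ≤ (2 * h * C) / (N : ℝ) := by
    intro N
    have e : (∑ n ∈ range N, w (n + h)) - ∑ n ∈ range N, w n
        = ∑ n ∈ range h, w (N + n) - ∑ n ∈ range h, w n := by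
      have e1 := sum_range_add w N h
      have e2 := sum_range_add w h N
      rw [add_comm h N] at e2
      simp_rw [add_comm h] at e2
      rw [e1] at e2
      rw [sub_eq_sub_iff_add_eq_add, add_comm, ← e2, add_comm]
    rw [← smul_sub, e, norm_smul, norm_inv, Complex.norm_natCast, div_eq_inv_mul]
    gcongr
    refine (norm_sub_le _ _).trans ?_
    have b1 := norm_sum_le_of_le (range h) (fun n _ => hC (N + n))
    have b2 := norm_sum_le_of_le (range h) (fun n _ => hC n)
    simp only [sum_const, card_range, nsmul_eq_mul] at b1 b2
    linarith
  exact squeeze_zero_norm hb (tendsto_const_div_atTop_nhds_zero_nat _)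

lemma aux_vdc {H : Type*} [NormedAddCommGroup H] [InnerProductSpace ℂ H] (u : ℕ → H) (C : ℝ)
    (hC : ∀ n, ‖u n‖ ≤ C) (γ : ℕ → ℂ)
    (hγ : ∀ k, Tendsto (fun N : ℕ => (N : ℂ)⁻¹ * ∑ n ∈ range N, ⟪u n, u (n + k)⟫_ℂ) atTop
      (𝓝 (γ k)))
    (h0 : Tendsto γ atTop (𝓝 0)) :
    Tendsto (fun N : ℕ => (N : ℂ)⁻¹ • ∑ n ∈ range N, u n) atTop (𝓝 0) := by
  rw [NormedAddGroup.tendsto_nhds_zero]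
  intro δ hδ
  set η : ℝ := δ ^ 2 / 16 with hη
  have hηp : 0 < η := by positivity
  have hC0 : 0 ≤ C := (norm_nonneg _).trans (hC 0)
  obtain ⟨M0, hM0⟩ := eventually_atTop.1 ((NormedAddGroup.tendsto_nhds_zero.1 h0) η hηp)
  obtain ⟨K0, hK0⟩ := exists_nat_ge (‖γ 0‖ / η)
  set K : ℕ := K0 + 1 with hK
  have hKη : ‖γ 0‖ ≤ K * η := by
    rw [div_le_iff₀ hηp] at hK0
    push_cast [hK]; nlinarith
  have hK1 : (1 : ℝ) ≤ K := by push_cast [hK]; linarith [Nat.cast_nonneg (α := ℝ) K0]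
  set M : ℕ := M0 + 1 with hM
  have key : ∀ j l : ℕ, j ≤ l → ∀ k, k = (l - j) * M →
      Tendsto (fun N : ℕ => (N : ℂ)⁻¹ * ∑ n ∈ range N, ⟪u (n + j * M), u (n + l * M)⟫_ℂ) atTop
      (𝓝 (γ k)) := by
    intro j l hjl k hk
    have hs := aux_shift (fun n => ⟪u n, u (n + k)⟫_ℂ) (C * C)
      (fun n => (norm_inner_le_norm _ _).trans (by gcongr <;> apply hC)) (j * M)
    have := hs.add (hγ k)
    rw [zero_add] at this
    refine this.congr fun N => ?_
    have e : ∀ n, n + j * M + k = n + l * M := by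
      intro n; rw [hk, add_assoc, ← add_mul]; congr 2; omega
    simp only [smul_eq_mul, sub_add_cancel, e]
  have key2 : ∀ j l : ℕ, ∃ Γ : ℂ, Tendsto (fun N : ℕ => (N : ℂ)⁻¹ *
      ∑ n ∈ range N, ⟪u (n + j * M), u (n + l * M)⟫_ℂ) atTop (𝓝 Γ) ∧
      ‖Γ‖ ≤ η + (if j = l then ‖γ 0‖ else 0) := by
    intro j l
    rcases lt_trichotomy j l with h | h | h
    · refine ⟨_, key j l h.le _ rfl, ?_⟩
      rw [if_neg h.ne, add_zero]
      refine (hM0 _ ?_).le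
      have : 1 ≤ l - j := by omega
      nlinarith
    · subst h
      refine ⟨_, key j j le_rfl 0 (by simp), ?_⟩
      simp [hηp.le]
    · refine ⟨star (γ ((j - l) * M)), ?_, ?_⟩
      · refine ((continuous_star.tendsto _).comp (key l j h.le _ rfl)).congr fun N => ?_
        simp
      · rw [if_neg h.ne', add_zero, norm_star]
        refine (hM0 _ ?_).le
        have : 1 ≤ j - l := by omega
        nlinarith
  choose Γ hΓ hΓb using key2
  set y : ℕ → H := fun n => ∑ j ∈ range K, u (n + j * M) with hy
  have hD : Tendsto (fun N : ℕ => (N : ℂ)⁻¹ * ∑ n ∈ range N, ⟪y n, y n⟫_ℂ) atTop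
      (𝓝 (∑ j ∈ range K, ∑ l ∈ range K, Γ j l)) := by
    refine (tendsto_finsetSum _ fun j _ => tendsto_finsetSum _ fun l _ => hΓ j l).congr fun N => ?_
    simp only [← mul_sum, hy, sum_inner, inner_sum]
    congr 1
    simp_rw [Finset.sum_comm (s := range K) (t := range N)]
    exact sum_congr rfl fun n _ => sum_comm
  have hGb : ‖∑ j ∈ range K, ∑ l ∈ range K, Γ j l‖ ≤ 2 * K ^ 2 * η := by
    refine (norm_sum_le_of_le _ fun j _ => norm_sum_le_of_le _ fun l _ => hΓb j l).trans ?_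
    have : ∀ j ∈ range K, ∑ l ∈ range K, (η + if j = l then ‖γ 0‖ else 0) = K * η + ‖γ 0‖ := by
      intro j hj
      rw [sum_add_distrib, sum_ite_eq, if_pos hj]; simp
    rw [sum_congr rfl this]
    simp only [sum_const, card_range, nsmul_eq_mul]
    nlinarith
  have hE1 : ∀ᶠ N : ℕ in atTop, ‖(N : ℂ)⁻¹ * ∑ n ∈ range N, ⟪y n, y n⟫_ℂ‖ < 3 * K ^ 2 * η := by
    refine (hD.norm).eventually_lt_const (lt_of_le_of_lt hGb ?_)
    have : 0 < (K : ℝ) ^ 2 * η := by positivity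
    linarith
  have hS : Tendsto (fun N : ℕ => (N : ℂ)⁻¹ • (∑ n ∈ range N, y n) -
      (K : ℂ) • ((N : ℂ)⁻¹ • ∑ n ∈ range N, u n)) atTop (𝓝 0) := by
    have := tendsto_finsetSum (range K) fun j _ => aux_shift u C hC (j * M)
    simp only [sum_const_zero] at this
    refine this.congr fun N => ?_
    rw [sum_sub_distrib, ← smul_sum, sum_comm]
    simp [hy, Nat.cast_smul_eq_nsmul]
  have hE2 := (NormedAddGroup.tendsto_nhds_zero.1 hS) (K * (δ / 2)) (by positivity)
  filter_upwards [hE1, hE2, eventually_gt_atTop 0] with N h1 h2 hN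
  have hNp : (0 : ℝ) < N := by exact_mod_cast hN
  have hz : ‖(N : ℂ)⁻¹ • (∑ n ∈ range N, y n)‖ ^ 2 ≤
      ‖(N : ℂ)⁻¹ * ∑ n ∈ range N, ⟪y n, y n⟫_ℂ‖ := by
    have e : ∑ n ∈ range N, ⟪y n, y n⟫_ℂ = ((∑ n ∈ range N, ‖y n‖ ^ 2 : ℝ) : ℂ) := by
      push_cast
      exact sum_congr rfl fun n _ => inner_self_eq_norm_sq_to_K _
    rw [e, norm_smul, norm_mul, norm_inv, Complex.norm_natCast, Complex.norm_real,
      Real.norm_of_nonneg (sum_nonneg fun _ _ => sq_nonneg _), mul_pow]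
    have t1 : ‖∑ n ∈ range N, y n‖ ^ 2 ≤ (∑ n ∈ range N, ‖y n‖) ^ 2 := by
      gcongr; exact norm_sum_le _ _
    have t2 := sq_sum_le_card_mul_sum_sq (s := range N) (f := fun n => ‖y n‖)
    rw [card_range] at t2
    calc (N : ℝ)⁻¹ ^ 2 * ‖∑ n ∈ range N, y n‖ ^ 2
        ≤ (N : ℝ)⁻¹ ^ 2 * (N * ∑ n ∈ range N, ‖y n‖ ^ 2) := by gcongr; exact t1.trans t2
      _ = _ := by field_simp
  have hz2 : ‖(N : ℂ)⁻¹ • (∑ n ∈ range N, y n)‖ < K * (δ / 2) := by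
    refine lt_of_pow_lt_pow_left₀ 2 (by positivity) ?_
    have : 0 < (K : ℝ) ^ 2 * η := by positivity
    have e : (K * (δ / 2)) ^ 2 = 4 * ((K : ℝ) ^ 2 * η) := by rw [hη]; ring
    rw [e]; linarith
  have hf : ‖(K : ℂ) • ((N : ℂ)⁻¹ • ∑ n ∈ range N, u n)‖ < K * δ := by
    have := norm_sub_le ((N : ℂ)⁻¹ • (∑ n ∈ range N, y n)) ((N : ℂ)⁻¹ • (∑ n ∈ range N, y n) -
      (K : ℂ) • ((N : ℂ)⁻¹ • ∑ n ∈ range N, u n))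
    rw [sub_sub_cancel] at this
    linarith
  rw [norm_smul, Complex.norm_natCast] at hf
  exact lt_of_mul_lt_mul_left hf (by positivity)

lemma aux_c (d : ℕ) (A : ℤ → Matrix (Fin 2) (Fin 2) (ZMod d)) (hA : A 0 = 1)
    (hc : Consistent d A) (I J : ℤ →₀ (ZMod d × ZMod d)) :
    cExp d A I J = Bexp d A I J + cExp d A J I := by
  have s0 : ∀ l : ZMod d × ZMod d, symp 0 l = 0 := by intro l; simp [symp]
  have m0 : ∀ B : Matrix (Fin 2) (Fin 2) (ZMod d), mvec B 0 = 0 := by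
    intro B; simp [mvec]
  have s1 : ∀ l : ZMod d × ZMod d, symp l 0 = 0 := by intro l; simp [symp]
  set s := I.support ∪ J.support with hs
  have hI : I.support ⊆ s := subset_union_left
  have hJ : J.support ⊆ s := subset_union_right
  have eI : ∀ K : ℤ →₀ (ZMod d × ZMod d), ∀ L : ℤ →₀ (ZMod d × ZMod d),
      K.support ⊆ s → L.support ⊆ s → cExp d A K L = (∑ a ∈ s, ∑ b ∈ s,
      if b < a then symp (K a) (mvec (A (b - a)) (L b)) else 0)
    + ∑ a ∈ s, (K a).1 * (L a).2 := by
    intro K L hK hL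
    unfold cExp
    congr 1
    · rw [sum_subset hK (fun a _ ha => by simp [Finsupp.notMem_support_iff.1 ha, s0])]
      refine sum_congr rfl fun a _ => ?_
      exact sum_subset hL (fun b _ hb => by simp [Finsupp.notMem_support_iff.1 hb, s1, m0])
    · exact sum_subset hK (fun a _ ha => by simp [Finsupp.notMem_support_iff.1 ha])
  have eB : Bexp d A I J = ∑ a ∈ s, ∑ b ∈ s, symp (I a) (mvec (A (b - a)) (J b)) := by
    unfold Bexp
    rw [sum_subset hI (fun a _ ha => by simp [Finsupp.notMem_support_iff.1 ha, s0])]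
    refine sum_congr rfl fun a _ => ?_
    exact sum_subset hJ (fun b _ hb => by simp [Finsupp.notMem_support_iff.1 hb, s1, m0])
  have ed : ∀ K L : ℤ →₀ (ZMod d × ZMod d), ∑ a ∈ s, (K a).1 * (L a).2 =
      ∑ a ∈ s, ∑ b ∈ s, if a = b then (K a).1 * (L a).2 else 0 := by
    intro K L
    refine sum_congr rfl fun a ha => ?_
    rw [sum_ite_eq, if_pos ha]
  rw [eI I J hI hJ, eI J I hJ hI, eB, ed I J, ed J I,
    sum_comm (f := fun a b => if b < a then symp (J a) (mvec (A (b - a)) (I b)) else 0)]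
  simp only [← sum_add_distrib]
  refine sum_congr rfl fun a _ => sum_congr rfl fun b _ => ?_
  rcases lt_trichotomy a b with h | h | h
  · have := hc (a - b) (I a) (J b)
    rw [neg_sub] at this
    simp [h, h.ne, h.not_gt, this]
  · subst h
    simp [hA, mvec, symp]; ring
  · simp [h, h.ne', h.not_gt]

lemma aux_Sg {d : ℕ} (y : ℤ → Matrix (Fin 2) (Fin 2) (ZMod d)) (I J : ℤ →₀ (ZMod d × ZMod d)) :
    Bexp d y I (Sg J) = Bexp d (Tsh y) I J := by
  unfold Bexp
  refine sum_congr rfl fun a _ => ?_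
  symm
  refine sum_equiv (Equiv.addRight (1 : ℤ)) ?_ ?_
  · intro i; simp [Sg, Finsupp.equivMapDomain_apply]
  · intro i _
    simp only [Sg, Finsupp.equivMapDomain_apply, Equiv.symm_apply_apply, Tsh]
    congr 3
    simp; ring

lemma aux_Sg_iter {d : ℕ} (n : ℕ) (y : ℤ → Matrix (Fin 2) (Fin 2) (ZMod d))
    (I J : ℤ →₀ (ZMod d × ZMod d)) :
    Bexp d y I (Sg^[n] J) = Bexp d (Tsh^[n] y) I J := by
  induction n generalizing y with
  | zero => rfl
  | succ n ih => rw [Function.iterate_succ_apply', aux_Sg, ih, Function.iterate_succ_apply]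

lemma aux_cont (d : ℕ) (I : ℤ →₀ (ZMod d × ZMod d)) :
    Continuous (fun y : ℤ → Matrix (Fin 2) (Fin 2) (ZMod d) =>
      Complex.exp (2 * Real.pi * Complex.I * ((Bexp d y I I).val : ℂ) / d)) := by
  have h : Continuous (fun y : ℤ → Matrix (Fin 2) (Fin 2) (ZMod d) => Bexp d y I I) := by
    unfold Bexp symp mvec
    fun_prop
  exact (continuous_of_discreteTopology (f := fun z : ZMod d =>
    Complex.exp (2 * Real.pi * Complex.I * (z.val : ℂ) / d))).comp h

lemma aux_avg {H : Type*} [NormedAddCommGroup H] [InnerProductSpace ℂ H] [CompleteSpace H]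
    (U : H ≃ₗᵢ[ℂ] H) :
    ∃ P : H → H, (∀ v, ∃ p : ℝ, 0 ≤ p ∧ ⟪v, P v⟫_ℂ = p ∧ (p = 0 → P v = 0)) ∧
      (∀ w v, U w = w → ⟪w, P v⟫_ℂ = ⟪w, v⟫_ℂ) ∧
      (∀ v, Tendsto (fun N : ℕ => (N : ℂ)⁻¹ • ∑ n ∈ range N, U^[n] v) atTop (𝓝 (P v))) := by
  set T : H →L[ℂ] H := (U.toContinuousLinearEquiv : H →L[ℂ] H) with hT
  set S := T.eqLocus (1 : H →L[ℂ] H) with hS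
  refine ⟨fun v => (S.orthogonalProjectionOnto v : H), fun v => ?_, fun w v hw => ?_, fun v => ?_⟩
  · refine ⟨‖S.orthogonalProjectionOnto v‖ ^ 2, by positivity, ?_, fun h => ?_⟩
    · have : ⟪v, (S.orthogonalProjectionOnto v : H)⟫_ℂ
          = ⟪(S.orthogonalProjectionOnto v : H), (S.orthogonalProjectionOnto v : H)⟫_ℂ := by
        exact (S.inner_orthogonalProjectionOnto_eq_of_mem_right
          (S.orthogonalProjectionOnto v) v).symm
      rw [this, inner_self_eq_norm_sq_to_K]; simp
    · have : S.orthogonalProjectionOnto v = 0 := norm_eq_zero.1 (pow_eq_zero_iff two_ne_zero |>.1 h)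
      simp [this]
  · have hwS : w ∈ S := by rw [hS, LinearMap.mem_eqLocus]; simpa [hT] using hw
    exact S.inner_orthogonalProjectionOnto_eq_of_mem_left ⟨w, hwS⟩ v
  · have hn : ‖T‖ ≤ 1 := T.opNorm_le_bound zero_le_one (fun y => by simp [hT])
    exact T.tendsto_birkhoffAverage_orthogonalProjection hn v

lemma aux_weighted {d : ℕ} (μ : Measure (ℤ → Matrix (Fin 2) (Fin 2) (ZMod d)))
    [IsProbabilityMeasure μ]
    (x : ℤ → Matrix (Fin 2) (Fin 2) (ZMod d)) (hx : Typical d μ x)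
    (f : (ℤ → Matrix (Fin 2) (Fin 2) (ZMod d)) → ℂ) (hf : Continuous f) (hf1 : ∀ y, ‖f y‖ ≤ 1)
    {H : Type*} [NormedAddCommGroup H] [InnerProductSpace ℂ H]
    (U : H ≃ₗᵢ[ℂ] H) (v : H) :
    Tendsto (fun N : ℕ => (N : ℂ)⁻¹ • ∑ n ∈ range N,
      (f (Tsh^[n] x) - ∫ y, f y ∂μ) • U^[n] v) atTop (𝓝 0) := by
  have : BorelSpace (ℤ → Matrix (Fin 2) (Fin 2) (ZMod d)) := ⟨rfl⟩
  set m := ∫ y, f y ∂μ with hm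
  have hint : Integrable f μ :=
    Integrable.of_bound hf.measurable.aestronglyMeasurable 1 (ae_of_all _ hf1)
  have hnorm : ∀ n (y : H), ‖U^[n] y‖ = ‖y‖ := by
    intro n y
    induction n with
    | zero => rfl
    | succ n ih => rw [Function.iterate_succ_apply', U.norm_map, ih]
  have hinner : ∀ n (y z : H), ⟪U^[n] y, U^[n] z⟫_ℂ = ⟪y, z⟫_ℂ := by
    intro n y z
    induction n with
    | zero => rfl
    | succ n ih => rw [Function.iterate_succ_apply', Function.iterate_succ_apply',
        U.inner_map_map, ih]
  have i0 : ∫ y, (f y - m) ∂μ = 0 := by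
    rw [integral_sub hint (integrable_const _)]; simp [hm]
  obtain ⟨c, hc, hc0⟩ := hx.2 (fun y => star (f y - m)) (fun y => f y - m)
    (by fun_prop) (by fun_prop)
  rw [i0, mul_zero] at hc0
  refine aux_vdc _ ((1 + ‖m‖) * ‖v‖) (fun n => ?_) (fun k => c k * ⟪v, U^[k] v⟫_ℂ) (fun k => ?_) ?_
  · rw [norm_smul, hnorm]
    gcongr
    exact (norm_sub_le _ _).trans (by gcongr; exact hf1 _)
  · refine ((hc k).mul_const _).congr fun N => ?_
    rw [mul_assoc, sum_mul]
    congr 1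
    refine sum_congr rfl fun n _ => ?_
    rw [inner_smul_left, inner_smul_right, Function.iterate_add_apply U n k, hinner, mul_assoc]
    rfl
  · refine squeeze_zero_norm (a := fun k => ‖c k‖ * (‖v‖ * ‖v‖)) (fun k => ?_) ?_
    · rw [norm_mul]
      gcongr
      refine (norm_inner_le_norm _ _).trans ?_
      rw [hnorm]
    · simpa using hc0.norm.mul_const (‖v‖ * ‖v‖)

/-- Theorem 2: For a typical nondegenerate sequence of matrices, the tracial
state is the only translation-invariant state on the twisted Weyl algebra: if `x` is
typical for the shift-invariant probability measure `μ`, satisfies `A 0 = 1` and the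
consistency condition, and `∫ F_I dμ ≠ 1` for every `I ≠ 0`, then for every Hilbert space
`H`, unit vector `Ω`, projective unitary representation `π` with multiplier `ω`, and
unitary `U` fixing `Ω` and implementing the shift, the vector state is tracial. -/
theorem stmt14 (d : ℕ) (hd : 2 ≤ d)
    (μ : Measure (ℤ → Matrix (Fin 2) (Fin 2) (ZMod d))) [IsProbabilityMeasure μ]
    (hinv : MeasurePreserving (Tsh (d := d)) μ μ)
    (x : ℤ → Matrix (Fin 2) (Fin 2) (ZMod d)) (hx : Typical d μ x)
    (hx0 : x 0 = 1) (hcons : Consistent d x)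
    (hnondeg : ∀ I : ℤ →₀ (ZMod d × ZMod d), I ≠ 0 →
      (∫ y, Complex.exp (2 * Real.pi * Complex.I * ((Bexp d y I I).val : ℂ) / d) ∂μ) ≠ 1)
    {H : Type*} [NormedAddCommGroup H] [InnerProductSpace ℂ H] [CompleteSpace H]
    (Ω : H) (hΩ : ‖Ω‖ = 1)
    (pr : (ℤ →₀ (ZMod d × ZMod d)) → (H →L[ℂ] H))
    (hu : ∀ I, pr I ∈ unitary (H →L[ℂ] H))
    (h1 : pr 0 = 1)
    (hmul : ∀ I J, pr I ∘L pr J = omegaMul d x I J • pr (I + J))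
    (U : H ≃ₗᵢ[ℂ] H) (hUΩ : U Ω = Ω)
    (hint : ∀ I y, U (pr I (U.symm y)) = pr (Sg I) y) :
    (∀ I, I ≠ 0 → ⟪Ω, pr I Ω⟫_ℂ = 0) ∧
      ∀ I J, ⟪Ω, pr I (pr J Ω)⟫_ℂ = ⟪Ω, pr J (pr I Ω)⟫_ℂ := by
  have : NeZero d := ⟨by omega⟩
  have hexp : ∀ z : ZMod d, Complex.exp (2 * Real.pi * Complex.I * (z.val : ℂ) / d)
      = ZMod.stdAddChar z := fun z => by rw [ZMod.stdAddChar_apply, ZMod.toCircle_apply]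
  have hmul' : ∀ I J y, pr I (pr J y) = omegaMul d x I J • pr (I + J) y := by
    intro I J y
    have := congrArg (fun T : H →L[ℂ] H => T y) (hmul I J)
    simpa using this
  have hcomm : ∀ I J y, pr I (pr J y) =
      (ZMod.stdAddChar (Bexp d x I J) : ℂ) • pr J (pr I y) := by
    intro I J y
    rw [hmul', hmul', omegaMul, omegaMul, hexp, hexp, aux_c d x hx0 hcons I J,
      AddChar.map_add_eq_mul, add_comm J I, smul_smul]
  have hsu : ∀ I y, star (pr I) (pr I y) = y := by
    intro I y
    have := congrArg (fun T : H →L[ℂ] H => T y) (Unitary.mem_iff.1 (hu I)).1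
    simpa using this
  have hus : ∀ I y, pr I (star (pr I) y) = y := by
    intro I y
    have := congrArg (fun T : H →L[ℂ] H => T y) (Unitary.mem_iff.1 (hu I)).2
    simpa using this
  have hL : ∀ I y z, ⟪y, pr I z⟫_ℂ = ⟪star (pr I) y, z⟫_ℂ := by
    intro I y z
    rw [ContinuousLinearMap.star_eq_adjoint, ContinuousLinearMap.adjoint_inner_left]
  have hL' : ∀ I y z, ⟪y, star (pr I) z⟫_ℂ = ⟪pr I y, z⟫_ℂ := by
    intro I y z
    rw [ContinuousLinearMap.star_eq_adjoint, ContinuousLinearMap.adjoint_inner_right]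
  have hSg : ∀ n I y, pr (Sg^[n] I) (U^[n] y) = U^[n] (pr I y) := by
    intro n I y
    induction n with
    | zero => rfl
    | succ n ih =>
      rw [Function.iterate_succ_apply', Function.iterate_succ_apply',
        Function.iterate_succ_apply', ← hint, U.symm_apply_apply, ih]
  have hUn : ∀ n, U^[n] Ω = Ω := fun n => Function.iterate_fixed hUΩ n
  have hv : ∀ n I, pr (Sg^[n] I) Ω = U^[n] (pr I Ω) := by
    intro n I
    have := hSg n I Ω
    rwa [hUn] at this
  have hvs : ∀ n I, star (pr (Sg^[n] I)) Ω = U^[n] (star (pr I) Ω) := by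
    intro n I
    have := hSg n I (star (pr I) Ω)
    rw [hus, hUn] at this
    rw [← this, hsu, this]
  obtain ⟨P, hP1, hP2, hP3⟩ := aux_avg U
  have main : ∀ I, I ≠ 0 → ⟪Ω, pr I Ω⟫_ℂ = 0 := by
    intro I hI
    set F : (ℤ → Matrix (Fin 2) (Fin 2) (ZMod d)) → ℂ := fun y =>
      Complex.exp (2 * Real.pi * Complex.I * ((Bexp d y I I).val : ℂ) / d) with hF
    have hFc : Continuous F := aux_cont d I
    have hF1 : ∀ y, ‖F y‖ ≤ 1 := by
      intro y
      simp only [hF]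
      rw [hexp, ZMod.stdAddChar_apply, Circle.norm_coe]
    have hFm := hnondeg I hI
    have hFn : ∀ n y, pr I (pr (Sg^[n] I) y) = F (Tsh^[n] x) • pr (Sg^[n] I) (pr I y) := by
      intro n y
      simp only [hF]
      rw [hcomm, aux_Sg_iter, hexp]
    set m := ∫ y, F y ∂μ with hm
    have hw : ∀ v w : H, Tendsto (fun N : ℕ => (N : ℂ)⁻¹ * ∑ n ∈ range N,
        F (Tsh^[n] x) * ⟪w, U^[n] v⟫_ℂ) atTop (𝓝 (m * ⟪w, P v⟫_ℂ)) := by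
      intro v w
      have t := (aux_weighted μ x hx F hFc hF1 U v).add ((hP3 v).const_smul m)
      rw [zero_add] at t
      have t2 := (Filter.Tendsto.inner (𝕜 := ℂ) (tendsto_const_nhds (x := w)) t)
      rw [inner_smul_right] at t2
      refine t2.congr fun N => ?_
      rw [smul_comm m, ← smul_add, smul_sum, ← sum_add_distrib, inner_smul_right, inner_sum]
      congr 1
      refine sum_congr rfl fun n _ => ?_
      rw [← add_smul, sub_add_cancel, inner_smul_right]
    have hw1 : ∀ v : H, Tendsto (fun N : ℕ => (N : ℂ)⁻¹ * ∑ n ∈ range N,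
        ⟪U^[n] v, v⟫_ℂ) atTop (𝓝 (star ⟪v, P v⟫_ℂ)) := by
      intro v
      have t2 := (Filter.Tendsto.inner (𝕜 := ℂ) (tendsto_const_nhds (x := v)) (hP3 v))
      refine ((continuous_star.tendsto _).comp t2).congr fun N => ?_
      simp [inner_smul_right, inner_sum]
    obtain ⟨p, hp0, hp, hpz⟩ := hP1 (pr I Ω)
    obtain ⟨q, hq0, hq, -⟩ := hP1 (star (pr I) Ω)
    have e1 : (q : ℂ) = m * p := by
      have a := hw1 (star (pr I) Ω)
      have b := hw (pr I Ω) (pr I Ω)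
      rw [hp] at b
      rw [hq] at a
      have := tendsto_nhds_unique (a.congr fun N => ?_) b
      · simpa using this
      · congr 1
        refine sum_congr rfl fun n _ => ?_
        rw [← hvs, ← hL, ← hv, ← hL', ← inner_smul_right]
        congr 1
        have := hFn n (star (pr I) Ω)
        rw [hus] at this
        rw [← map_smul, ← hsu I (pr (Sg^[n] I) (star (pr I) Ω)), this]
    have e2 : (p : ℂ) = m * q := by
      have a := hw1 (pr I Ω)
      have b := hw (star (pr I) Ω) (star (pr I) Ω)
      rw [hp] at a
      rw [hq] at b
      have := tendsto_nhds_unique (a.congr fun N => ?_) b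
      · simpa using this
      · congr 1
        refine sum_congr rfl fun n _ => ?_
        rw [← hv, ← hL', ← hvs, ← hL, ← inner_smul_right]
        congr 1
        have := hFn n (star (pr (Sg^[n] I)) Ω)
        rw [hus] at this
        rw [this, map_smul, hsu]
    have hpz' : p = 0 := by
      by_contra hpn
      have hpc : (p : ℂ) ≠ 0 := by exact_mod_cast hpn
      have hm2 : (m - 1) * (m + 1) = 0 := by
        have : (p : ℂ) * ((m - 1) * (m + 1)) = 0 := by
          linear_combination -e2 - m * e1
        exact (mul_eq_zero.1 this).resolve_left hpc
      have hm1 : m + 1 = 0 := (mul_eq_zero.1 hm2).resolve_left (sub_ne_zero.2 hFm)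
      have hqp : (q : ℂ) = -p := by linear_combination e1 + p * hm1
      have hqp' : q = -p := by exact_mod_cast hqp
      exact hpn (by linarith)
    rw [← hP2 Ω _ hUΩ, hpz hpz', inner_zero_right]
  refine ⟨main, fun I J => ?_⟩
  by_cases h : I + J = 0
  · have a := fun y => hmul' I J y
    simp only [h, h1, one_apply_eq_self] at a
    have b : pr J (pr I Ω) = omegaMul d x I J • Ω := by
      rw [← hsu I (pr J (pr I Ω)), a, map_smul, hsu]
    rw [a, b]
  · rw [hmul', hmul', inner_smul_right, inner_smul_right, main _ h, add_comm J I, main _ h]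
    simp
end
end
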